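/- Let Z be a complex Banach space, w ∈ ℂ with Re(w) > 0, τ > 0, q ≥ 1, t ≥ 0, and let c ∈ ℝ^q satisfy t + τ c_i ≥ 0 for all i. Let γ ∈ ℂ^q satisfy Σ_{i=1}^q γ_i c_i^j = j! w^j for 0 ≤ j ≤ q−1. Then for every h : [0,∞) → Z of class C^q with h^{(q)} bounded, defining φ(t) := (τw)^{−1} ∫_0^∞ exp(−s/(τw)) h(t+s) ds, one has ‖ φ(t) − Σ_{i=1}^q γ_i h(t + τ c_i) ‖ ≤ ( |w|^{2q+1}/(Re w)^{q+1} + Σ_{i=1}^q |γ_i| |c_i|^q / q! ) · τ^q · sup_{s ≥ 0} ‖h^{(q)}(s)‖. -/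

import Mathlib

open MeasureTheory Set in
theorem aux_taylor {E : Type*} [NormedAddCommGroup E] [NormedSpace ℝ E] (b M : ℝ) (n : ℕ) :
    ∀ f : ℝ → E, ContDiff ℝ n f → (∀ s ∈ Icc (0:ℝ) b, ‖iteratedDeriv n f s‖ ≤ M) →
    ∀ s ∈ Icc (0:ℝ) b,
      ‖f s - ∑ k ∈ Finset.range n, (s ^ k / (k.factorial : ℝ)) • iteratedDeriv k f 0‖
        ≤ M * (s ^ n / (n.factorial : ℝ)) := by
  induction n with
  | zero =>
    intro f hf hM s hs
    simpa using hM s hs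
  | succ n ih =>
    intro f hf hM
    have hf' : ContDiff ℝ n (deriv f) := by
      have := (contDiff_succ_iff_deriv (n := (n : WithTop ℕ∞)) (f := f)).1 (by exact_mod_cast hf)
      exact this.2.2
    have hd : Differentiable ℝ f := hf.differentiable (by simp)
    have hpow : ∀ (k : ℕ) (x : ℝ), HasDerivAt (fun s : ℝ => s ^ (k+1) / ((k+1).factorial : ℝ))
        (x ^ k / (k.factorial : ℝ)) x := by
      intro k x
      have h1 := (hasDerivAt_pow (k+1) x).div_const ((k+1).factorial : ℝ)
      refine h1.congr_deriv ?_
      have : (k.factorial : ℝ) ≠ 0 := by positivity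
      have : (k : ℝ) + 1 ≠ 0 := by positivity
      rw [Nat.factorial_succ]
      push_cast
      field_simp
    have ih' := ih (deriv f) hf' (fun s hs => by
      rw [← iteratedDeriv_succ']; exact hM s hs)
    have hD : ∀ x : ℝ, HasDerivAt
        (fun s => f s - ∑ k ∈ Finset.range (n+1), (s ^ k / (k.factorial : ℝ)) • iteratedDeriv k f 0)
        (deriv f x - ∑ k ∈ Finset.range n, (x ^ k / (k.factorial : ℝ)) •
          iteratedDeriv k (deriv f) 0) x := by
      intro x
      apply (hd x).hasDerivAt.sub
      simp_rw [Finset.sum_range_succ']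
      have : HasDerivAt (fun s : ℝ => ∑ k ∈ Finset.range n,
          (s ^ (k+1) / ((k+1).factorial : ℝ)) • iteratedDeriv (k+1) f 0)
          (∑ k ∈ Finset.range n, (x ^ k / (k.factorial : ℝ)) •
          iteratedDeriv k (deriv f) 0) x := by
        apply HasDerivAt.fun_sum
        intro k _
        rw [← iteratedDeriv_succ']
        exact (hpow k x).smul_const _
      simpa using this.add_const (f 0)
    apply image_norm_le_of_norm_deriv_right_le_deriv_boundary
      (fun x _ => (hD x).continuousAt.continuousWithinAt)
      (fun x _ => (hD x).hasDerivWithinAt) (B' := fun x => M * (x ^ n / (n.factorial : ℝ)))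
    · simp [Finset.sum_range_succ']
    · intro x
      exact (hpow n x).const_mul M
    · intro x hx
      exact ih' x ⟨hx.1, hx.2.le⟩

theorem aux_taylor2 {E : Type*} [NormedAddCommGroup E] [NormedSpace ℝ E] (M : ℝ) (n : ℕ)
    (f : ℝ → E) (hf : ContDiff ℝ n f) (hM : ∀ s, 0 ≤ s → ‖iteratedDeriv n f s‖ ≤ M)
    (t d : ℝ) (ht : 0 ≤ t) (htd : 0 ≤ t + d) :
      ‖f (t + d) - ∑ k ∈ Finset.range n, (d ^ k / (k.factorial : ℝ)) • iteratedDeriv k f t‖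
        ≤ M * (|d| ^ n / (n.factorial : ℝ)) := by
  have hg : ContDiff ℝ n (fun z => f (t + z)) := by fun_prop
  have key : ∀ k ≤ n, ∀ s, iteratedDeriv k (fun s : ℝ => f (t + d * s)) s
      = d ^ k • iteratedDeriv k f (t + d * s) := by
    intro k hk s
    have h1 := iteratedDeriv_comp_const_smul (n := k) (f := fun z => f (t + z))
      (hg.of_le (by exact_mod_cast hk)) d
    have h2 := congrFun h1 s
    rw [iteratedDeriv_comp_const_add] at h2
    exact h2
  have := aux_taylor 1 (M * |d| ^ n) n (fun s : ℝ => f (t + d * s)) (by fun_prop) (by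
    intro s hs
    rw [key n le_rfl, norm_smul, norm_pow, Real.norm_eq_abs, mul_comm]
    gcongr
    apply hM
    nlinarith [hs.1, hs.2]) 1 (by simp)
  calc _ = _ := ?_
    _ ≤ _ := this
    _ = _ := by ring
  congr 1
  simp only [mul_one]
  congr 1
  apply Finset.sum_congr rfl
  intro k hk
  rw [key k (Finset.mem_range.1 hk).le, smul_smul]
  congr 1
  · simp; ring
  · simp

open MeasureTheory Set Filter in
theorem aux_int_real (r : ℝ) (hr : 0 < r) (j : ℕ) :
    IntegrableOn (fun s : ℝ => Real.exp (-(r * s)) * (s ^ j / (j.factorial : ℝ))) (Ioi 0) := by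
  have h := Real.integral_rpow_mul_exp_neg_mul_Ioi (a := (j : ℝ) + 1) (r := r)
    (by positivity) hr
  have h3 : IntegrableOn (fun t : ℝ => t ^ ((j : ℝ) + 1 - 1) * Real.exp (-(r * t))) (Ioi 0) := by
    apply Integrable.of_integral_ne_zero
    rw [h]
    have := Real.Gamma_pos_of_pos (s := (j : ℝ) + 1) (by positivity)
    positivity
  refine IntegrableOn.congr_fun (h3.const_mul (1 / (j.factorial : ℝ))) (fun s hs => ?_) measurableSet_Ioi
  simp only [add_sub_cancel_right, Real.rpow_natCast]
  ring

open MeasureTheory Set Filter in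
theorem aux_int (a : ℂ) (ha : 0 < a.re) (j : ℕ) :
    IntegrableOn (fun s : ℝ => Complex.exp (-(a * s)) * ((s : ℂ) ^ j / (j.factorial : ℂ))) (Ioi 0) ∧
    ∫ s in Ioi (0:ℝ), Complex.exp (-(a * s)) * ((s : ℂ) ^ j / (j.factorial : ℂ)) = (1 / a) ^ (j+1) := by
  have ha0 : a ≠ 0 := by rintro rfl; simp at ha
  have hnorm : ∀ (j : ℕ) (s : ℝ), 0 < s →
      ‖Complex.exp (-(a * s)) * ((s : ℂ) ^ j / (j.factorial : ℂ))‖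
        = Real.exp (-(a.re * s)) * (s ^ j / (j.factorial : ℝ)) := by
    intro j s hs
    rw [norm_mul, Complex.norm_exp, norm_div, norm_pow, Complex.norm_real,
      Real.norm_of_nonneg hs.le, Complex.norm_natCast]
    simp
  have hInt : ∀ j : ℕ, IntegrableOn
      (fun s : ℝ => Complex.exp (-(a * s)) * ((s : ℂ) ^ j / (j.factorial : ℂ))) (Ioi 0) := by
    intro j
    refine Integrable.mono' (aux_int_real a.re ha j) ?_ ?_
    · apply Continuous.aestronglyMeasurable
      fun_prop
    · exact (ae_restrict_iff' measurableSet_Ioi).2 (ae_of_all _ fun s hs => (hnorm j s hs).le)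
  refine ⟨hInt j, ?_⟩
  induction j with
  | zero =>
    have := integral_exp_mul_complex_Ioi (a := -a) (by simpa using ha) 0
    simpa using this
  | succ j ih =>
    have hder : ∀ s : ℝ, HasDerivAt
        (fun s : ℝ => Complex.exp (-(a * s)) * ((s : ℂ) ^ (j+1) / ((j+1).factorial : ℂ)))
        (Complex.exp (-(a * s)) * ((s : ℂ) ^ j / (j.factorial : ℂ)) -
          a * (Complex.exp (-(a * s)) * ((s : ℂ) ^ (j+1) / ((j+1).factorial : ℂ)))) s := by
      intro s
      have e1 : HasDerivAt (fun z : ℂ => Complex.exp (-(a * z)))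
          (Complex.exp (-(a * s)) * -(a * 1)) (s : ℂ) :=
        (((hasDerivAt_id (s : ℂ)).const_mul a).neg).cexp
      have e2 := (hasDerivAt_pow (j+1) (s : ℂ)).div_const ((j+1).factorial : ℂ)
      refine ((e1.mul e2).comp_ofReal).congr_deriv ?_
      have h1 : (j.factorial : ℂ) ≠ 0 := by exact_mod_cast j.factorial_ne_zero
      have h2 : (j : ℂ) + 1 ≠ 0 := by exact_mod_cast j.succ_ne_zero
      rw [Nat.factorial_succ]
      push_cast
      field_simp
      ring
    have hlim : Tendsto
        (fun s : ℝ => Complex.exp (-(a * s)) * ((s : ℂ) ^ (j+1) / ((j+1).factorial : ℂ)))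
        atTop (nhds 0) := by
      rw [tendsto_zero_iff_norm_tendsto_zero]
      have := (tendsto_rpow_mul_exp_neg_mul_atTop_nhds_zero ((j+1 : ℕ) : ℝ) a.re ha).mul_const
        (1 / ((j+1).factorial : ℝ))
      rw [zero_mul] at this
      refine this.congr' ?_
      filter_upwards [eventually_gt_atTop 0] with s hs
      rw [hnorm _ _ hs, Real.rpow_natCast, neg_mul]
      ring
    have := integral_Ioi_of_hasDerivAt_of_tendsto' (a := (0:ℝ)) (fun s _ => hder s)
      ((hInt j).sub ((hInt (j+1)).const_mul a)) hlim
    rw [integral_sub (hInt j) ((hInt (j+1)).const_mul a), integral_const_mul, ih] at this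
    simp only [Complex.ofReal_zero, ne_eq, Nat.add_eq_zero_iff, one_ne_zero, and_false,
      not_false_eq_true, zero_pow, zero_div, mul_zero, sub_zero] at this
    rw [pow_succ, sub_eq_zero.1 this, mul_one_div, mul_div_cancel_left₀ _ ha0]

open MeasureTheory Set in
theorem aux_main {Z : Type*} [NormedAddCommGroup Z] [NormedSpace ℂ Z] [CompleteSpace Z]
    (a : ℂ) (ha : 0 < a.re) (q : ℕ) (f : ℝ → Z) (hf : Continuous f) (v : ℕ → Z) (M : ℝ)
    (hM : ∀ s, 0 < s → ‖f s - ∑ k ∈ Finset.range q, (s ^ k / (k.factorial : ℝ)) • v k‖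
        ≤ M * (s ^ q / (q.factorial : ℝ))) :
    ‖a • (∫ s in Ioi (0:ℝ), Complex.exp (-(a * s)) • f s)
      - ∑ k ∈ Finset.range q, (1 / a) ^ k • v k‖ ≤ ‖a‖ * (M * (1 / a.re) ^ (q+1)) := by
  have ha0 : a ≠ 0 := by rintro rfl; simp at ha
  set R : ℝ → Z := fun s => f s - ∑ k ∈ Finset.range q, (s ^ k / (k.factorial : ℝ)) • v k with hR
  have hRc : Continuous R := by fun_prop
  have hr := aux_int (a.re : ℂ) (by simpa using ha) q
  have hcast : (fun s : ℝ => Complex.exp (-((a.re : ℂ) * s)) * ((s : ℂ) ^ q / (q.factorial : ℂ)))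
      = fun s : ℝ => ((Real.exp (-(a.re * s)) * (s ^ q / (q.factorial : ℝ)) : ℝ) : ℂ) := by
    ext s; push_cast; rfl
  rw [hcast] at hr
  have hr1 : IntegrableOn (fun s : ℝ => Real.exp (-(a.re * s)) * (s ^ q / (q.factorial : ℝ)))
      (Ioi 0) := by
    have := hr.1.re
    exact this
  have hr2 : ∫ s in Ioi (0:ℝ), Real.exp (-(a.re * s)) * (s ^ q / (q.factorial : ℝ))
      = (1 / a.re) ^ (q+1) := by
    have := hr.2
    rw [integral_complex_ofReal] at this
    exact_mod_cast this
  have hbound : ∀ᵐ s : ℝ ∂(volume.restrict (Ioi (0:ℝ))), ‖Complex.exp (-(a * s)) • R s‖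
      ≤ M * (Real.exp (-(a.re * s)) * (s ^ q / (q.factorial : ℝ))) := by
    refine (ae_restrict_iff' measurableSet_Ioi).2 (ae_of_all _ fun s hs => ?_)
    rw [norm_smul, Complex.norm_exp]
    have : (-(a * (s:ℂ))).re = -(a.re * s) := by simp
    rw [this]
    calc _ ≤ Real.exp (-(a.re * s)) * (M * (s ^ q / (q.factorial : ℝ))) := by
          gcongr; exact hM s hs
      _ = _ := by ring
  have hRint : IntegrableOn (fun s : ℝ => Complex.exp (-(a * s)) • R s) (Ioi 0) := by
    refine Integrable.mono' (hr1.const_mul M) ?_ hbound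
    apply Continuous.aestronglyMeasurable
    fun_prop
  have hPint : ∀ k ∈ Finset.range q, IntegrableOn (fun s : ℝ => (Complex.exp (-(a * s)) *
      ((s : ℂ) ^ k / (k.factorial : ℂ))) • v k) (Ioi 0) :=
    fun k _ => (aux_int a ha k).1.smul_const _
  have hsplit : ∀ s : ℝ, Complex.exp (-(a * s)) • f s = Complex.exp (-(a * s)) • R s +
      ∑ k ∈ Finset.range q, (Complex.exp (-(a * s)) * ((s : ℂ) ^ k / (k.factorial : ℂ))) • v k := by
    intro s
    have : ∑ k ∈ Finset.range q, (Complex.exp (-(a * s)) * ((s : ℂ) ^ k / (k.factorial : ℂ))) • v k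
        = Complex.exp (-(a * s)) • ∑ k ∈ Finset.range q, (s ^ k / (k.factorial : ℝ)) • v k := by
      rw [Finset.smul_sum]
      refine Finset.sum_congr rfl fun k _ => ?_
      rw [mul_smul, ← Complex.coe_smul (s ^ k / (k.factorial : ℝ)) (v k)]
      push_cast; rfl
    rw [this, ← smul_add, hR]
    simp
  have hI : ∫ s in Ioi (0:ℝ), Complex.exp (-(a * s)) • f s =
      (∫ s in Ioi (0:ℝ), Complex.exp (-(a * s)) • R s) +
        ∑ k ∈ Finset.range q, (1 / a) ^ (k+1) • v k := by
    simp_rw [hsplit]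
    rw [integral_add hRint (integrable_finsetSum _ hPint), integral_finsetSum _ hPint]
    congr 1
    refine Finset.sum_congr rfl fun k _ => ?_
    rw [integral_smul_const, (aux_int a ha k).2]
  have hfin : a • (∫ s in Ioi (0:ℝ), Complex.exp (-(a * s)) • f s)
      - ∑ k ∈ Finset.range q, (1 / a) ^ k • v k
      = a • ∫ s in Ioi (0:ℝ), Complex.exp (-(a * s)) • R s := by
    rw [hI, smul_add, Finset.smul_sum, add_sub_assoc, sub_eq_zero.2, add_zero]
    refine Finset.sum_congr rfl fun k _ => ?_
    rw [smul_smul]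
    congr 1
    rw [pow_succ', ← mul_assoc, mul_one_div_cancel ha0, one_mul]
  rw [hfin, norm_smul]
  gcongr
  rw [← hr2, ← integral_const_mul]
  exact norm_integral_le_of_norm_le (hr1.const_mul M) hbound


/-- Simple-pole instance of the approximation (13) of the paper: for the
resolvent `φ = (I − τwB)⁻¹h` of the translation semigroup and weights `γ`
solving `Σ_i γ_i c_i^j = j! w^j`, the combination `γᵀ h(t+τc)` approximates
`φ(t)` to order `q` in `τ`. -/
theorem stmt19
    {Z : Type*} [NormedAddCommGroup Z] [NormedSpace ℂ Z] [CompleteSpace Z]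
    (w : ℂ) (hw : 0 < w.re) (τ : ℝ) (hτ : 0 < τ) (q : ℕ) (hq : 1 ≤ q)
    (t : ℝ) (ht : 0 ≤ t)
    (c : Fin q → ℝ) (hc : ∀ i, 0 ≤ t + τ * c i)
    (γ : Fin q → ℂ)
    (hγ : ∀ j : Fin q, ∑ i, γ i * (c i : ℂ) ^ (j : ℕ)
      = ((j : ℕ).factorial : ℂ) * w ^ (j : ℕ))
    (h : ℝ → Z) (hh : ContDiff ℝ q h)
    (hbd : ∃ C : ℝ, ∀ s : ℝ, 0 ≤ s → ‖iteratedDeriv q h s‖ ≤ C) :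
    letI φ : ℝ → Z := fun t' =>
      ((τ : ℂ) * w)⁻¹ • ∫ s in Set.Ioi (0 : ℝ),
        Complex.exp (-(s : ℂ) / ((τ : ℂ) * w)) • h (t' + s)
    ‖φ t - ∑ i, γ i • h (t + τ * c i)‖
      ≤ (‖w‖ ^ (2 * q + 1) / w.re ^ (q + 1)
            + ∑ i, ‖γ i‖ * |c i| ^ q / q.factorial) * τ ^ q
          * ⨆ s : Set.Ici (0 : ℝ), ‖iteratedDeriv q h s‖ := by
  set φ : ℝ → Z := fun t' =>
      ((τ : ℂ) * w)⁻¹ • ∫ s in Set.Ioi (0 : ℝ),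
        Complex.exp (-(s : ℂ) / ((τ : ℂ) * w)) • h (t' + s) with hφdef
  obtain ⟨C, hC⟩ := hbd
  set M := ⨆ s : Set.Ici (0 : ℝ), ‖iteratedDeriv q h s‖ with hMdef
  have hM : ∀ s, 0 ≤ s → ‖iteratedDeriv q h s‖ ≤ M := by
    intro s hs
    exact le_ciSup (f := fun s : Set.Ici (0 : ℝ) => ‖iteratedDeriv q h s‖)
      ⟨C, by rintro _ ⟨s, rfl⟩; exact hC s s.2⟩ ⟨s, hs⟩
  have hw0 : w ≠ 0 := by rintro rfl; simp at hw
  have hτ0 : (τ : ℂ) ≠ 0 := by exact_mod_cast hτ.ne'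
  have hT := fun d hd => aux_taylor2 M q h hh hM t d ht hd
  clear_value φ
  set a : ℂ := ((τ : ℂ) * w)⁻¹ with ha_def
  have hare : a.re = w.re / (τ * ‖w‖ ^ 2) := by
    rw [ha_def, Complex.inv_re, Complex.normSq_eq_norm_sq, norm_mul, Complex.norm_real,
      Real.norm_of_nonneg hτ.le, Complex.re_ofReal_mul]
    field_simp
  have hwn : 0 < ‖w‖ := norm_pos_iff.2 hw0
  have ha : 0 < a.re := by rw [hare]; positivity
  have h1 := aux_main a ha q (fun s => h (t + s)) (hh.continuous.comp (by fun_prop))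
    (fun k => iteratedDeriv k h t) M (fun s hs => by
      have := hT s (by linarith)
      rwa [abs_of_pos hs] at this)
  have hφ : φ t = a • (∫ s in Set.Ioi (0:ℝ), Complex.exp (-(a * s)) • h (t + s)) := by
    rw [hφdef]
    show a • _ = _
    congr 2
    ext s
    congr 2
    rw [ha_def]; field_simp
  have hsum : ∑ k ∈ Finset.range q, (1 / a) ^ k • iteratedDeriv k h t
      = ∑ i, γ i • ∑ k ∈ Finset.range q,
        ((τ * c i) ^ k / (k.factorial : ℝ)) • iteratedDeriv k h t := by
    simp_rw [Finset.smul_sum]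
    rw [Finset.sum_comm]
    refine Finset.sum_congr rfl fun k hk => ?_
    have := hγ ⟨k, Finset.mem_range.1 hk⟩
    simp only at this
    have hf : (k.factorial : ℂ) ≠ 0 := by exact_mod_cast k.factorial_ne_zero
    have e : (1 / a) ^ k = ∑ i, γ i * (((τ * c i) ^ k / (k.factorial : ℝ) : ℝ) : ℂ) := by
      calc (1 / a) ^ k = (τ : ℂ) ^ k / (k.factorial : ℂ) * ((k.factorial : ℂ) * w ^ k) := by
            rw [ha_def, one_div, inv_inv, mul_pow]; field_simp
        _ = _ := by
            rw [← this, Finset.mul_sum]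
            refine Finset.sum_congr rfl fun i _ => ?_
            push_cast
            ring
    rw [e, Finset.sum_smul]
    refine Finset.sum_congr rfl fun i _ => ?_
    rw [mul_smul, Complex.coe_smul]
  have h2 : ‖∑ i, γ i • (h (t + τ * c i) - ∑ k ∈ Finset.range q,
        ((τ * c i) ^ k / (k.factorial : ℝ)) • iteratedDeriv k h t)‖
      ≤ ∑ i, ‖γ i‖ * (M * (|τ * c i| ^ q / (q.factorial : ℝ))) := by
    refine norm_sum_le_of_le _ fun i _ => ?_
    rw [norm_smul]
    gcongr
    exact hT _ (hc i)
  have hdec : φ t - ∑ i, γ i • h (t + τ * c i)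
      = (a • (∫ s in Set.Ioi (0:ℝ), Complex.exp (-(a * s)) • h (t + s))
        - ∑ k ∈ Finset.range q, (1 / a) ^ k • iteratedDeriv k h t)
      - ∑ i, γ i • (h (t + τ * c i) - ∑ k ∈ Finset.range q,
        ((τ * c i) ^ k / (k.factorial : ℝ)) • iteratedDeriv k h t) := by
    simp_rw [smul_sub]
    rw [Finset.sum_sub_distrib, ← hsum, hφ]
    abel
  rw [hdec]
  refine (norm_sub_le _ _).trans ((add_le_add h1 h2).trans (le_of_eq ?_))
  rw [add_mul, add_mul, Finset.sum_mul, Finset.sum_mul]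
  congr 1
  · have : ‖a‖ = (τ * ‖w‖)⁻¹ := by
      rw [ha_def, norm_inv, norm_mul, Complex.norm_real, Real.norm_of_nonneg hτ.le]
    rw [this, hare]
    simp only [one_div, inv_div, div_pow, mul_pow]
    field_simp
    ring
  · refine Finset.sum_congr rfl fun i _ => ?_
    rw [abs_mul, abs_of_pos hτ, mul_pow]
    ring
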